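/- Let X ⊆ ℂ^d be an open, holomorphically convex set (for instance a domain of holomorphy), let w : X → ℂ and ψ : X → X be holomorphic, and assume that for every m ∈ ℕ₀ the set {z ∈ X : w(ψ^m(z)) ≠ 0} is dense in X. Then the following are equivalent: (i) C_{w,ψ} is power bounded on ℋ(X): for every compact K ⊆ X there exist a compact L ⊆ X and C > 0 with sup_{z∈K}|C_{w,ψ}^m(f)(z)| ≤ C sup_{u∈L}|f(u)| for all m ∈ ℕ and f ∈ ℋ(X); (ii) C_{w,ψ} is topologizable on ℋ(X) (for every compact K there is a compact L such that for every m there is γ_m > 0 with sup_{z∈K}|C_{w,ψ}^m(f)(z)| ≤ γ_m sup_{u∈L}|f(u)| for all f ∈ ℋ(X)) and the set {C_{w,ψ}^m(w) : m ∈ ℕ} is bounded in ℋ(X); (iii) ψ has stable orbits and {C_{w,ψ}^m(w) : m ∈ ℕ} is bounded in ℋ(X). Moreover, if w = 1, these are further equivalent to: (iv) the composition operator C_ψ is mean ergodic on ℋ(X), i.e., for every f ∈ ℋ(X) the Cesàro means (1/n)∑_{m=1}^n f∘ψ^m converge uniformly on every compact subset of X to some element of ℋ(X). -/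

import Mathlib

open scoped BigOperators

noncomputable section

namespace PBC
open Filter Topology Set Metric

variable {d : ℕ}

local notation "V" => EuclideanSpace ℂ (Fin d)

lemma le_sup {K : Set V} (hK : IsCompact K) {f : V → ℂ} (hf : ContinuousOn f K) {u : V}
    (hu : u ∈ K) : ‖f u‖ ≤ ⨆ u ∈ K, ‖f u‖ := by
  obtain ⟨M, hM⟩ := hK.exists_bound_of_continuousOn hf
  have hM0 : 0 ≤ M := (norm_nonneg _).trans (hM u hu)
  have h1 : BddAbove (range fun u => ⨆ (_ : u ∈ K), ‖f u‖) := by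
    refine ⟨M, ?_⟩
    rintro _ ⟨v, rfl⟩
    exact Real.iSup_le (fun hv => hM v hv) hM0
  refine le_trans ?_ (le_ciSup h1 u)
  simp [hu]

lemma sup_le {K : Set V} {f : V → ℂ} {B : ℝ} (hB : 0 ≤ B) (h : ∀ u ∈ K, ‖f u‖ ≤ B) :
    (⨆ u ∈ K, ‖f u‖) ≤ B :=
  Real.iSup_le (fun u => Real.iSup_le (fun hu => h u hu) hB) hB

lemma sup_nonneg (K : Set V) (f : V → ℂ) : 0 ≤ ⨆ u ∈ K, ‖f u‖ :=
  Real.iSup_nonneg fun _ => Real.iSup_nonneg fun _ => norm_nonneg _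

lemma le_of_pow {a b c γ : ℝ} (hb : 0 ≤ b) (hc : 0 < c)
    (h : ∀ k : ℕ, c * a ^ k ≤ γ * b ^ k) : a ≤ b := by
  by_contra hab
  push Not at hab
  have ha : 0 < a := hb.trans_lt hab
  have hγ : 0 < γ := by
    have := h 0
    simp at this
    linarith
  obtain ⟨k, hk⟩ := exists_pow_lt_of_lt_one (div_pos hc hγ) ((div_lt_one ha).2 hab)
  rw [div_pow, div_lt_div_iff₀ (pow_pos ha k) hγ] at hk
  have := h k
  linarith

lemma mem_hull {X : Set V} {L : Set V} (hL : IsCompact L) (hLX : L ⊆ X) {p : V}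
    {c γ : ℝ} (hc : 0 < c)
    (h : ∀ f : V → ℂ, DifferentiableOn ℂ f X → c * ‖f p‖ ≤ γ * ⨆ u ∈ L, ‖f u‖)
    (hγ : 0 ≤ γ)
    (f : V → ℂ) (hf : DifferentiableOn ℂ f X) : ‖f p‖ ≤ ⨆ u ∈ L, ‖f u‖ := by
  refine le_of_pow (sup_nonneg _ _) hc (γ := γ) fun k => ?_
  have := h (fun z => f z ^ k) (hf.pow k)
  rw [norm_pow] at this
  refine this.trans (mul_le_mul_of_nonneg_left ?_ hγ)
  refine sup_le (pow_nonneg (sup_nonneg _ _) k) fun u hu => ?_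
  rw [norm_pow]
  exact pow_le_pow_left₀ (norm_nonneg _) (le_sup hL (hf.continuousOn.mono hLX) hu) k

lemma iter_mapsTo {X : Set V} {ψ : V → V} (h : MapsTo ψ X X) (m : ℕ) : MapsTo ψ^[m] X X :=
  h.iterate m

lemma iter_diff {X : Set V} {ψ : V → V} (h : MapsTo ψ X X) (hψ : DifferentiableOn ℂ ψ X) (m : ℕ) :
    DifferentiableOn ℂ ψ^[m] X := by
  induction m with
  | zero => exact differentiableOn_id
  | succ k ih =>
    rw [Function.iterate_succ']
    exact hψ.comp ih (h.iterate k)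

lemma prod_diff {X : Set V} {ψ : V → V} (h : MapsTo ψ X X) (hψ : DifferentiableOn ℂ ψ X)
    {w : V → ℂ} (hw : DifferentiableOn ℂ w X) (m : ℕ) :
    DifferentiableOn ℂ (fun z => ∏ j ∈ Finset.range m, w (ψ^[j] z)) X := by
  induction m with
  | zero => simp
  | succ k ih =>
    simp only [Finset.prod_range_succ]
    exact ih.mul (hw.comp (iter_diff h hψ k) (h.iterate k))

lemma dense_prod {X : Set V} {ψ : V → V} (h : MapsTo ψ X X)
    (hψ : DifferentiableOn ℂ ψ X) {w : V → ℂ} (hw : DifferentiableOn ℂ w X)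
    (hdense : ∀ m : ℕ, X ⊆ closure {z ∈ X | w (ψ^[m] z) ≠ 0}) (m : ℕ)
    (U : Set V) (hU : IsOpen U) (hUX : U ⊆ X) (hne : U.Nonempty) :
    ∃ z ∈ U, ∏ j ∈ Finset.range m, w (ψ^[j] z) ≠ 0 := by
  induction m with
  | zero => obtain ⟨z, hz⟩ := hne; exact ⟨z, hz, by simp⟩
  | succ k ih =>
    obtain ⟨y, hy, hy0⟩ := ih
    have ho := (prod_diff h hψ hw k).continuousOn.mono hUX |>.isOpen_inter_preimage hU
      (isOpen_compl_singleton (x := (0 : ℂ)))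
    obtain ⟨z, hz, hz2⟩ := mem_closure_iff.1 (hdense k (hUX hy)) _ ho ⟨hy, hy0⟩
    refine ⟨z, hz.1, ?_⟩
    rw [Finset.prod_range_succ]
    exact mul_ne_zero hz.2 hz2.2

lemma stable_of_top {X : Set V} (hX : IsOpen X)
    (hconv : ∀ K : Set V, IsCompact K → K ⊆ X →
      IsCompact {z ∈ X | ∀ f : V → ℂ,
        DifferentiableOn ℂ f X → ‖f z‖ ≤ ⨆ u ∈ K, ‖f u‖})
    {ψ : V → V} (h : MapsTo ψ X X)
    (hψ : DifferentiableOn ℂ ψ X) {w : V → ℂ} (hw : DifferentiableOn ℂ w X)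
    (hdense : ∀ m : ℕ, X ⊆ closure {z ∈ X | w (ψ^[m] z) ≠ 0})
    (htop : ∀ K : Set V, IsCompact K → K ⊆ X →
        ∃ L : Set V, IsCompact L ∧ L ⊆ X ∧
          ∀ m : ℕ, 1 ≤ m → ∃ γ : ℝ, 0 < γ ∧
            ∀ f : V → ℂ, DifferentiableOn ℂ f X →
              (⨆ z ∈ K, ‖(∏ j ∈ Finset.range m, w (ψ^[j] z)) * f (ψ^[m] z)‖) ≤
                γ * ⨆ u ∈ L, ‖f u‖)
    (K : Set V) (hK : IsCompact K) (hKX : K ⊆ X) :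
    ∃ L : Set V, IsCompact L ∧ L ⊆ X ∧ ∀ m : ℕ, 1 ≤ m → ψ^[m] '' K ⊆ L := by
  obtain ⟨K', hK', hKK', hK'X⟩ := exists_compact_between hK hX hKX
  obtain ⟨L, hL, hLX, hγ⟩ := htop K' hK' hK'X
  refine ⟨_, hconv L hL hLX, fun z hz => hz.1, ?_⟩
  intro m hm
  rintro _ ⟨z, hz, rfl⟩
  by_contra hcon
  have hiX : interior K' ⊆ X := interior_subset.trans hK'X
  have ho := (iter_diff h hψ m).continuousOn.mono hiX |>.isOpen_inter_preimage isOpen_interior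
    (hconv L hL hLX).isClosed.isOpen_compl
  obtain ⟨y, hy, hy0⟩ := dense_prod h hψ hw hdense m _ ho (fun z hz => hiX hz.1)
    ⟨z, hKK' hz, hcon⟩
  obtain ⟨γ, hγ0, hγ⟩ := hγ m hm
  refine hy.2 ⟨h.iterate m (hiX hy.1), fun f hf => ?_⟩
  refine mem_hull hL hLX (norm_pos_iff.2 hy0) (γ := γ) (fun f hf => ?_) hγ0.le f hf
  rw [← norm_mul]
  refine le_trans ?_ (hγ f hf)
  have hd : DifferentiableOn ℂ
      (fun z => (∏ j ∈ Finset.range m, w (ψ^[j] z)) * f (ψ^[m] z)) X :=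
    (prod_diff h hψ hw m).mul (hf.comp (iter_diff h hψ m) (h.iterate m))
  exact le_sup hK' (hd.continuousOn.mono hK'X) (interior_subset hy.1)

lemma pb_of_stable {X : Set V} {ψ : V → V} {w : V → ℂ} (hw : DifferentiableOn ℂ w X)
    (hst : ∀ K : Set V, IsCompact K → K ⊆ X →
        ∃ L : Set V, IsCompact L ∧ L ⊆ X ∧ ∀ m : ℕ, 1 ≤ m → ψ^[m] '' K ⊆ L)
    (hbd : ∀ K : Set V, IsCompact K → K ⊆ X →
        ∃ M : ℝ, ∀ m : ℕ, 1 ≤ m → ∀ z ∈ K,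
          ‖(∏ j ∈ Finset.range m, w (ψ^[j] z)) * w (ψ^[m] z)‖ ≤ M)
    (K : Set V) (hK : IsCompact K) (hKX : K ⊆ X) :
    ∃ L : Set V, IsCompact L ∧ L ⊆ X ∧ ∃ C : ℝ, 0 < C ∧
          ∀ m : ℕ, 1 ≤ m → ∀ f : V → ℂ, DifferentiableOn ℂ f X →
            (⨆ z ∈ K, ‖(∏ j ∈ Finset.range m, w (ψ^[j] z)) * f (ψ^[m] z)‖) ≤
              C * ⨆ u ∈ L, ‖f u‖ := by
  obtain ⟨L, hL, hLX, hst⟩ := hst K hK hKX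
  obtain ⟨M, hM⟩ := hbd K hK hKX
  obtain ⟨M', hM'⟩ := hK.exists_bound_of_continuousOn (hw.continuousOn.mono hKX)
  refine ⟨L, hL, hLX, max 1 (max M M'), by positivity, fun m hm f hf => ?_⟩
  refine sup_le (mul_nonneg (by positivity) (sup_nonneg _ _)) fun z hz => ?_
  rw [norm_mul]
  refine mul_le_mul ?_ (le_sup hL (hf.continuousOn.mono hLX) (hst m hm ⟨z, hz, rfl⟩))
    (norm_nonneg _) (by positivity)
  refine le_trans ?_ (le_max_right _ _)
  obtain ⟨k, rfl⟩ : ∃ k, m = k + 1 := ⟨m - 1, by omega⟩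
  rcases Nat.eq_zero_or_pos k with rfl | hk
  · simpa using Or.inr (hM' z hz)
  · rw [Finset.prod_range_succ]
    exact (hM k hk z hz).trans (le_max_left _ _)

/-- Weierstrass theorem on balls. -/
lemma weierstrass {ι : Type*} {l : Filter ι} [l.NeBot] {F : ι → V → ℂ} {g : V → ℂ} {x : V} {r : ℝ}
    (hr : 0 < r) (hF : ∀ n, DifferentiableOn ℂ (F n) (ball x (2 * r)))
    (hlim : TendstoUniformlyOn F g l (ball x (2 * r))) : DifferentiableAt ℂ g x := by
  have hsub : ∀ y ∈ ball x r, ball y r ⊆ ball x (2 * r) := fun y hy =>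
    ball_subset_ball' (by rw [mem_ball] at hy; linarith)
  have hsub2 : ball x r ⊆ ball x (2 * r) := ball_subset_ball (by linarith)
  have hda : ∀ n, ∀ y ∈ ball x r, DifferentiableAt ℂ (F n) y := fun n y hy =>
    (hF n).differentiableAt (isOpen_ball.mem_nhds (hsub2 hy))
  have hC : UniformCauchySeqOn (fun n => fderiv ℂ (F n)) l (ball x r) := by
    intro u hu
    obtain ⟨ε, hε, hεu⟩ := Metric.mem_uniformity_dist.1 hu
    have hδ : 0 < ε * r / 4 := by positivity
    filter_upwards [hlim.uniformCauchySeqOn _ (Metric.dist_mem_uniformity hδ)] with n hn y hy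
    apply hεu
    rw [dist_eq_norm, ← fderiv_sub (hda _ y hy) (hda _ y hy)]
    have hb : ∀ v ∈ ball y r, ‖(F n.1 - F n.2) v‖ ≤ ε * r / 4 := fun v hv => by
      have h1 : dist (F n.1 v) (F n.2 v) < ε * r / 4 := hn v (hsub y hy hv)
      rw [dist_eq_norm] at h1
      exact h1.le
    have h2 := Complex.norm_fderiv_le_div_of_mapsTo_ball (f := F n.1 - F n.2) (c := y) (R₁ := r)
      (R₂ := ε * r / 2) (((hF n.1).sub (hF n.2)).mono (hsub y hy)) (fun v hv => by
        rw [mem_closedBall, dist_eq_norm]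
        refine (norm_sub_le _ _).trans ?_
        linarith [hb v hv, hb y (mem_ball_self hr)]) hr
    refine h2.trans_lt ?_
    rw [div_lt_iff₀ hr]
    nlinarith [mul_pos hε hr]
  have hpt : ∀ y ∈ ball x r, ∃ a, Tendsto (fun n => fderiv ℂ (F n) y) l (𝓝 a) := fun y hy =>
    cauchy_map_iff_exists_tendsto.1 (hC.cauchy_map hy)
  choose! g' hg' using hpt
  have := hasFDerivAt_of_tendstoUniformlyOn (𝕜 := ℂ) isOpen_ball
    (hC.tendstoUniformlyOn_of_tendsto hg')
    (fun n y hy => (hda n y hy).hasFDerivAt)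
    (fun y hy => hlim.tendsto_at (hsub2 hy)) (mem_ball_self hr)
  exact this.differentiableAt

lemma montel {X : Set V} (hX : IsOpen X) {F : ℕ → V → ℂ} (hF : ∀ n, DifferentiableOn ℂ (F n) X)
    (hb : ∀ K : Set V, IsCompact K → K ⊆ X → ∃ M : ℝ, ∀ n, ∀ z ∈ K, ‖F n z‖ ≤ M) :
    ∃ g : V → ℂ, DifferentiableOn ℂ g X ∧ ∃ l : Filter ℕ, l.NeBot ∧ l ≤ atTop ∧
      ∀ K : Set V, IsCompact K → K ⊆ X → TendstoUniformlyOn F g l K := by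
  have hpt : ∀ z ∈ X, ∃ a, Tendsto (fun n => F n z) (hyperfilter ℕ) (𝓝 a) := by
    intro z hz
    obtain ⟨M, hM⟩ := hb {z} isCompact_singleton (by simpa using hz)
    obtain ⟨a, -, ha⟩ := (isCompact_closedBall (0 : ℂ) M).ultrafilter_le_nhds'
      ((hyperfilter ℕ).map fun n => F n z)
      (by
        rw [Ultrafilter.mem_map]
        exact Filter.univ_mem' fun n => by simpa using hM n z rfl)
    exact ⟨a, ha⟩
  choose! g hg using hpt
  have heq : ∀ x ∈ X, EquicontinuousAt F x := by
    intro x hx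
    obtain ⟨r, hr, hrX⟩ := Metric.nhds_basis_closedBall.mem_iff.1 (hX.mem_nhds hx)
    obtain ⟨M, hM⟩ := hb _ (isCompact_closedBall x r) hrX
    refine Metric.equicontinuousAt_of_continuity_modulus (fun z => 2 * M / r * dist x z) ?_ F ?_
    · have : Continuous fun z : V => 2 * M / r * dist x z := by fun_prop
      simpa using this.tendsto x
    · filter_upwards [ball_mem_nhds x hr] with z hz n
      rw [dist_comm (F n x), dist_comm x]
      refine Complex.dist_le_div_mul_dist_of_mapsTo_ball
        ((hF n).mono (ball_subset_closedBall.trans hrX)) (fun v hv => ?_) hz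
      rw [mem_closedBall, dist_eq_norm]
      refine (norm_sub_le _ _).trans ?_
      linarith [hM n v (ball_subset_closedBall hv), hM n x (mem_closedBall_self hr.le)]
  have hunif : ∀ K : Set V, IsCompact K → K ⊆ X →
      TendstoUniformlyOn F g (hyperfilter ℕ : Filter ℕ) K := by
    intro K hK hKX
    have h1 := (EquicontinuousOn.tendsto_uniformOnFun_iff_pi' (F := F) (𝔖 := {K})
      (by rintro _ rfl; exact hK)
      (by intro K' hK' x hx; exact (heq x (hKX (hK' ▸ hx))).equicontinuousWithinAt K')
      (hyperfilter ℕ : Filter ℕ) g).2 (by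
        rw [tendsto_pi_nhds]
        rintro ⟨x, hx⟩
        exact hg x (hKX (by simpa using hx)))
    exact UniformOnFun.tendsto_iff_tendstoUniformlyOn.1 h1 K rfl
  refine ⟨g, ?_, _, inferInstance, Nat.hyperfilter_le_atTop, hunif⟩
  intro x hx
  obtain ⟨r, hr, hrX⟩ := Metric.nhds_basis_closedBall.mem_iff.1 (hX.mem_nhds hx)
  have hs : ball x (2 * (r / 2)) ⊆ closedBall x r := by
    rw [mul_div_cancel₀ r two_ne_zero]
    exact ball_subset_closedBall
  exact (weierstrass (half_pos hr) (fun n => (hF n).mono (hs.trans hrX))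
    ((hunif _ (isCompact_closedBall x r) hrX).mono hs)).differentiableWithinAt

lemma seq_shift (b : ℕ → ℂ) {S : ℝ} (hb : ∀ m, ‖b m‖ ≤ S) (n k : ℕ) :
    ‖∑ m ∈ Finset.range n, (b m - b (m + k))‖ ≤ 2 * k * S := by
  induction k with
  | zero => simp
  | succ k ih =>
    have h1 : ∑ m ∈ Finset.range n, (b m - b (m + (k + 1))) =
        ∑ m ∈ Finset.range n, (b m - b (m + k)) + (b k - b (n + k)) := by
      have := Finset.sum_range_sub' (fun m => b (m + k)) n
      simp only [zero_add] at this
      rw [← this, ← Finset.sum_add_distrib]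
      refine Finset.sum_congr rfl fun m _ => ?_
      rw [show m + 1 + k = m + (k + 1) by ring]
      ring
    rw [h1]
    refine (norm_add_le _ _).trans ?_
    have := norm_sub_le (b k) (b (n + k))
    push_cast
    linarith [hb k, hb (n + k)]

lemma seq_avg (b : ℕ → ℂ) {S : ℝ} (hb : ∀ m, ‖b m‖ ≤ S) (n p : ℕ) (hp : 1 ≤ p) :
    ‖∑ m ∈ Finset.range n, (b m - (p : ℂ)⁻¹ * ∑ i ∈ Finset.range p, b (m + (i + 1)))‖
      ≤ 2 * p * S := by
  have hS : 0 ≤ S := (norm_nonneg _).trans (hb 0)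
  have hp0 : (p : ℂ) ≠ 0 := by exact_mod_cast (by omega : p ≠ 0)
  have hp1 : (0 : ℝ) < p := by exact_mod_cast hp
  have h1 : ∑ m ∈ Finset.range n, (b m - (p : ℂ)⁻¹ * ∑ i ∈ Finset.range p, b (m + (i + 1))) =
      (p : ℂ)⁻¹ * ∑ i ∈ Finset.range p, ∑ m ∈ Finset.range n, (b m - b (m + (i + 1))) := by
    rw [Finset.sum_comm, Finset.mul_sum]
    refine Finset.sum_congr rfl fun m _ => ?_
    rw [Finset.sum_sub_distrib, mul_sub]
    simp [hp0]
  rw [h1, norm_mul, norm_inv, Complex.norm_natCast, inv_mul_le_iff₀ hp1]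
  refine (norm_sum_le _ _).trans ?_
  refine (Finset.sum_le_card_nsmul _ _ (2 * p * S) fun i hi => ?_).trans (by simp)
  refine (seq_shift b hb n (i + 1)).trans ?_
  have : ((i + 1 : ℕ) : ℝ) ≤ p := by exact_mod_cast Finset.mem_range.1 hi
  nlinarith

lemma ergodic_of_stable {X : Set V} (hX : IsOpen X) {ψ : V → V} (h : MapsTo ψ X X)
    (hψ : DifferentiableOn ℂ ψ X)
    (hst : ∀ K : Set V, IsCompact K → K ⊆ X →
        ∃ L : Set V, IsCompact L ∧ L ⊆ X ∧ ∀ m : ℕ, 1 ≤ m → ψ^[m] '' K ⊆ L)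
    (f : V → ℂ) (hf : DifferentiableOn ℂ f X) :
    ∃ g : V → ℂ, DifferentiableOn ℂ g X ∧
           ∀ K : Set V, IsCompact K → K ⊆ X →
             ∀ ε : ℝ, 0 < ε → ∃ N : ℕ, ∀ n : ℕ, N ≤ n → ∀ z ∈ K,
               ‖(n : ℂ)⁻¹ * (∑ m ∈ Finset.range n, f (ψ^[m + 1] z)) - g z‖ < ε := by
  have hbd : ∀ K : Set V, IsCompact K → K ⊆ X → ∃ L : Set V, IsCompact L ∧ L ⊆ X ∧
      ∃ S : ℝ, 0 ≤ S ∧ ∀ z ∈ K, ∀ m : ℕ, ψ^[m + 1] z ∈ L ∧ ‖f (ψ^[m + 1] z)‖ ≤ S := by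
    intro K hK hKX
    obtain ⟨L, hL, hLX, hm⟩ := hst K hK hKX
    obtain ⟨S, hS⟩ := hL.exists_bound_of_continuousOn (hf.continuousOn.mono hLX)
    refine ⟨L, hL, hLX, max S 0, le_max_right _ _, fun z hz m => ?_⟩
    have : ψ^[m + 1] z ∈ L := hm (m + 1) (by omega) ⟨z, hz, rfl⟩
    exact ⟨this, (hS _ this).trans (le_max_left _ _)⟩
  obtain ⟨g, hg, l, hl, hlt, hlim⟩ := montel hX
    (F := fun n z => (n : ℂ)⁻¹ * (∑ m ∈ Finset.range n, f (ψ^[m + 1] z)))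
    (fun n => DifferentiableOn.const_mul (DifferentiableOn.fun_sum fun m _ =>
      hf.comp (iter_diff h hψ (m + 1)) (h.iterate (m + 1))) _)
    (by
      intro K hK hKX
      obtain ⟨L, hL, hLX, S, hS0, hS⟩ := hbd K hK hKX
      refine ⟨S, fun n z hz => ?_⟩
      rcases Nat.eq_zero_or_pos n with rfl | hn
      · simpa using hS0
      have hn1 : (0 : ℝ) < n := by exact_mod_cast hn
      rw [norm_mul, norm_inv, Complex.norm_natCast, inv_mul_le_iff₀ hn1]
      refine (norm_sum_le _ _).trans ?_
      exact (Finset.sum_le_card_nsmul _ _ S fun i hi => (hS z hz i).2).trans (by simp))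
  have hpt : ∀ z ∈ X, Tendsto (fun n : ℕ => (n : ℂ)⁻¹ * (∑ m ∈ Finset.range n, f (ψ^[m + 1] z))) l
      (𝓝 (g z)) := fun z hz =>
    (hlim {z} isCompact_singleton (by simpa using hz)).tendsto_at rfl
  have hinv : ∀ z ∈ X, g (ψ z) = g z := by
    intro z hz
    have h1 := (hpt (ψ z) (h hz)).sub (hpt z hz)
    have h2 : Tendsto (fun n : ℕ => (n : ℂ)⁻¹ * (∑ m ∈ Finset.range n, f (ψ^[m + 1] (ψ z))) -
        (n : ℂ)⁻¹ * (∑ m ∈ Finset.range n, f (ψ^[m + 1] z))) l (𝓝 0) := by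
      refine Tendsto.mono_left ?_ hlt
      obtain ⟨L, hL, hLX, S, hS0, hS⟩ := hbd {z} isCompact_singleton (by simpa using hz)
      have h3 : Tendsto (fun n : ℕ => (2 * (1 : ℕ) * S) / (n : ℝ)) atTop (𝓝 0) :=
        tendsto_const_div_atTop_nhds_zero_nat _
      refine squeeze_zero_norm (fun n => ?_) h3
      rw [← mul_sub, ← Finset.sum_sub_distrib, norm_mul, norm_inv, Complex.norm_natCast,
        div_eq_inv_mul]
      refine mul_le_mul_of_nonneg_left ?_ (by positivity)
      have := seq_shift (fun m => f (ψ^[m + 1] z)) (fun m => (hS z rfl m).2) n 1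
      rw [← norm_neg, ← Finset.sum_neg_distrib] at this
      simp only [neg_sub] at this
      exact this
    have := tendsto_nhds_unique h1 h2
    exact sub_eq_zero.1 this
  have hinv' : ∀ z ∈ X, ∀ m : ℕ, g (ψ^[m] z) = g z := by
    intro z hz m
    induction m with
    | zero => rfl
    | succ k ih => rw [Function.iterate_succ_apply', hinv _ (h.iterate k hz), ih]
  refine ⟨g, hg, fun K hK hKX ε hε => ?_⟩
  obtain ⟨L, hL, hLX, S, hS0, hS⟩ := hbd K hK hKX
  obtain ⟨p, hp, hp1⟩ := ((Metric.tendstoUniformlyOn_iff.1 (hlim L hL hLX) (ε / 2)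
    (half_pos hε)).and (hlt (eventually_ge_atTop 1))).exists
  obtain ⟨N, hN⟩ := exists_nat_gt (2 * p * S / (ε / 2))
  refine ⟨N + 1, fun n hn z hz => ?_⟩
  have hn1 : (0 : ℝ) < n := by exact_mod_cast (by omega : 0 < n)
  have hn0 : (n : ℂ) ≠ 0 := by exact_mod_cast (by omega : n ≠ 0)
  have hNn : (N : ℝ) ≤ n := by exact_mod_cast (by omega : N ≤ n)
  have hkey : (n : ℂ)⁻¹ * (∑ m ∈ Finset.range n, f (ψ^[m + 1] z)) - g z =
      (n : ℂ)⁻¹ * (∑ m ∈ Finset.range n, (f (ψ^[m + 1] z) -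
        (p : ℂ)⁻¹ * ∑ i ∈ Finset.range p, f (ψ^[m + (i + 1) + 1] z))) +
      (n : ℂ)⁻¹ * ∑ m ∈ Finset.range n,
        ((p : ℂ)⁻¹ * (∑ i ∈ Finset.range p, f (ψ^[i + 1] (ψ^[m + 1] z))) - g (ψ^[m + 1] z)) := by
    rw [← mul_add, ← Finset.sum_add_distrib]
    have : ∀ m ∈ Finset.range n, (f (ψ^[m + 1] z) -
        (p : ℂ)⁻¹ * ∑ i ∈ Finset.range p, f (ψ^[m + (i + 1) + 1] z)) +
        ((p : ℂ)⁻¹ * (∑ i ∈ Finset.range p, f (ψ^[i + 1] (ψ^[m + 1] z))) - g (ψ^[m + 1] z))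
        = f (ψ^[m + 1] z) - g z := by
      intro m _
      rw [hinv' z (hKX hz)]
      have : ∀ i ∈ Finset.range p, f (ψ^[i + 1] (ψ^[m + 1] z)) = f (ψ^[m + (i + 1) + 1] z) := by
        intro i _
        rw [← Function.iterate_add_apply]
        congr 2
        ring
      rw [Finset.sum_congr rfl this]
      ring
    rw [Finset.sum_congr rfl this, Finset.sum_sub_distrib, mul_sub]
    simp [hn0]
  rw [hkey]
  have e1 : ‖(n : ℂ)⁻¹ * (∑ m ∈ Finset.range n, (f (ψ^[m + 1] z) -
        (p : ℂ)⁻¹ * ∑ i ∈ Finset.range p, f (ψ^[m + (i + 1) + 1] z)))‖ < ε / 2 := by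
    rw [norm_mul, norm_inv, Complex.norm_natCast, inv_mul_lt_iff₀ hn1]
    refine (seq_avg (fun m => f (ψ^[m + 1] z)) (fun m => (hS z hz m).2) n p hp1).trans_lt ?_
    rw [div_lt_iff₀ (half_pos hε)] at hN
    nlinarith
  have e2 : ‖(n : ℂ)⁻¹ * ∑ m ∈ Finset.range n,
        ((p : ℂ)⁻¹ * (∑ i ∈ Finset.range p, f (ψ^[i + 1] (ψ^[m + 1] z))) - g (ψ^[m + 1] z))‖
        ≤ ε / 2 := by
    rw [norm_mul, norm_inv, Complex.norm_natCast, inv_mul_le_iff₀ hn1]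
    refine (norm_sum_le _ _).trans ?_
    refine (Finset.sum_le_card_nsmul _ _ (ε / 2) fun m _ => ?_).trans (by simp)
    have := hp _ (hS z hz m).1
    rw [dist_comm, dist_eq_norm] at this
    exact this.le
  exact (norm_add_le _ _).trans_lt (by linarith)

/-- Holomorphic functions inside the continuous functions. -/
def Hol (X : Set V) : Set C(X, ℂ) :=
  {f | ∃ F : V → ℂ, DifferentiableOn ℂ F X ∧ ∀ x : X, F x = f x}

lemma isClosed_Hol {X : Set V} (hX : IsOpen X) : IsClosed (Hol X) := by
  classical
  refine isClosed_of_closure_subset fun f hf => ?_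
  have hne := mem_closure_iff_comap_neBot.1 hf
  have hlim : Tendsto (Subtype.val : Hol X → C(X, ℂ)) (comap Subtype.val (𝓝 f)) (𝓝 f) :=
    tendsto_comap
  rw [ContinuousMap.tendsto_iff_forall_isCompact_tendstoUniformlyOn] at hlim
  choose F hF hFf using fun g : Hol X => g.2
  refine ⟨fun z => if hz : z ∈ X then f ⟨z, hz⟩ else 0, ?_, fun x => by simp⟩
  intro x hx
  obtain ⟨r, hr, hrX⟩ := Metric.nhds_basis_closedBall.mem_iff.1 (hX.mem_nhds hx)
  have hs : ball x (2 * (r / 2)) ⊆ closedBall x r := by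
    rw [mul_div_cancel₀ r two_ne_zero]
    exact ball_subset_closedBall
  have hc : IsCompact ((Subtype.val : X → V) ⁻¹' closedBall x r) := by
    rw [Subtype.isCompact_iff, Subtype.image_preimage_coe, inter_eq_right.2 hrX]
    exact isCompact_closedBall x r
  refine (weierstrass (half_pos hr) (F := F) (l := comap Subtype.val (𝓝 f))
    (fun n => (hF n).mono (hs.trans hrX)) ?_).differentiableWithinAt
  intro u hu
  filter_upwards [hlim _ hc u hu] with n hn z hz
  have hzX := hrX (hs hz)
  have := hn ⟨z, hzX⟩ (hs hz)
  rw [← hFf] at this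
  simpa [hzX] using this

lemma top_of_pointwise {X : Set V} (hX : IsOpen X) {ψ : V → V} (h : MapsTo ψ X X)
    {K : Set V} (hKX : K ⊆ X)
    (hbd : ∀ f : V → ℂ, DifferentiableOn ℂ f X → ∃ M : ℝ, ∀ m : ℕ, 1 ≤ m → ∀ z ∈ K,
      ‖f (ψ^[m] z)‖ ≤ M * m) :
    ∃ L : Set V, IsCompact L ∧ L ⊆ X ∧ ∀ m : ℕ, 1 ≤ m → ∃ γ : ℝ, 0 < γ ∧
      ∀ f : V → ℂ, DifferentiableOn ℂ f X → ∀ z ∈ K, ‖f (ψ^[m] z)‖ ≤ γ * ⨆ u ∈ L, ‖f u‖ := by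
  have : LocallyCompactSpace X := hX.locallyCompactSpace
  have : CompleteSpace (Hol X) := (isClosed_Hol hX).completeSpace_coe
  have : BaireSpace (Hol X) := inferInstance
  let A : ℕ → Set (Hol X) := fun n => {f | ∀ m : ℕ, 1 ≤ m → ∀ z : V, ∀ hz : z ∈ K,
    ‖f.1 ⟨ψ^[m] z, h.iterate m (hKX hz)⟩‖ ≤ n * m}
  have hAc : ∀ n, IsClosed (A n) := by
    intro n
    simp only [A, ofPred_forall]
    refine isClosed_iInter fun m => isClosed_iInter fun _ => isClosed_iInter fun z =>
      isClosed_iInter fun hz => ?_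
    refine isClosed_le ?_ continuous_const
    exact ((continuous_eval_const _).comp continuous_subtype_val).norm
  have hAu : ⋃ n, A n = univ := by
    refine eq_univ_of_forall fun f => ?_
    obtain ⟨F, hF, hFf⟩ := f.2
    obtain ⟨M, hM⟩ := hbd F hF
    obtain ⟨n, hn⟩ := exists_nat_ge M
    refine mem_iUnion.2 ⟨n, fun m hm z hz => ?_⟩
    rw [← hFf]
    exact (hM m hm z hz).trans (mul_le_mul_of_nonneg_right hn (by positivity))
  have : Nonempty (Hol X) := ⟨⟨0, fun _ => 0, differentiableOn_const _, fun x => rfl⟩⟩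
  obtain ⟨n, f0, hf0⟩ := nonempty_interior_of_iUnion_of_closed hAc hAu
  have hnh : A n ∈ 𝓝 f0 := mem_interior_iff_mem_nhds.1 hf0
  obtain ⟨W, hW, hWA⟩ := mem_nhds_subtype _ _ _ |>.1 hnh
  obtain ⟨⟨L, ε⟩, ⟨hL, hε⟩, hLW⟩ := (nhds_basis_uniformity
    (Metric.uniformity_basis_dist_le.compactConvergenceUniformity)).mem_iff.1 hW
  simp only at hL hε hLW
  obtain ⟨F0, hF0, hFf0⟩ := f0.2
  -- small functions
  have hsmall : ∀ f : V → ℂ, DifferentiableOn ℂ f X → (∀ x : X, x ∈ L → ‖f x‖ ≤ ε) →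
      ∀ m : ℕ, 1 ≤ m → ∀ z ∈ K, ‖f (ψ^[m] z)‖ ≤ 2 * n * m := by
    intro f hf hfL m hm z hz
    let f1 : Hol X := ⟨⟨fun x => F0 x + f x,
        (hF0.continuousOn.add hf.continuousOn).domRestrict⟩,
      fun z => F0 z + f z, hF0.add hf, fun x => rfl⟩
    have h1 : f1 ∈ A n := by
      apply hWA
      apply hLW
      intro x hx
      change dist (F0 x + f x) (f0.1 x) ≤ ε
      rw [← hFf0, dist_eq_norm, add_sub_cancel_left]
      exact hfL x hx
    have h2 : f0 ∈ A n := interior_subset hf0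
    have h3 : ‖F0 (ψ^[m] z) + f (ψ^[m] z)‖ ≤ n * m := h1 m hm z hz
    have h4 := h2 m hm z hz
    rw [← hFf0] at h4
    have h5 := norm_sub_le (F0 (ψ^[m] z) + f (ψ^[m] z)) (F0 (ψ^[m] z))
    rw [add_sub_cancel_left] at h5
    simp only at h4
    linarith
  have hL' : IsCompact ((Subtype.val : X → V) '' L) := hL.image continuous_subtype_val
  have hLX' : ((Subtype.val : X → V) '' L) ⊆ X := by rintro _ ⟨x, -, rfl⟩; exact x.2
  refine ⟨_, hL', hLX', fun m hm => ⟨(2 * n * m + 1) / ε, by positivity, fun f hf z hz => ?_⟩⟩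
  have key : ∀ s : ℝ, 0 < s → (⨆ u ∈ ((Subtype.val : X → V) '' L), ‖f u‖) ≤ s →
      ‖f (ψ^[m] z)‖ ≤ (2 * n * m + 1) / ε * s := by
    intro s hs hsup
    have h1 := hsmall (fun z => ((ε / s : ℝ) : ℂ) * f z) (hf.const_mul _) (fun x hx => by
      rw [norm_mul, Complex.norm_real, Real.norm_of_nonneg (by positivity)]
      have := (le_sup hL' (hf.continuousOn.mono hLX') ⟨x, hx, rfl⟩).trans hsup
      calc ε / s * ‖f x‖ ≤ ε / s * s := by gcongr
        _ = ε := by field_simp) m hm z hz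
    rw [norm_mul, Complex.norm_real, Real.norm_of_nonneg (by positivity)] at h1
    rw [div_mul_eq_mul_div, le_div_iff₀ hε]
    rw [div_mul_eq_mul_div, div_le_iff₀ hs] at h1
    nlinarith
  refine le_of_forall_pos_le_add fun δ hδ => ?_
  have hc : (0 : ℝ) < (2 * n * m + 1) / ε := by positivity
  have := key ((⨆ u ∈ ((Subtype.val : X → V) '' L), ‖f u‖) + δ / ((2 * n * m + 1) / ε))
    (add_pos_of_nonneg_of_pos (sup_nonneg _ _) (by positivity))
    (le_add_of_nonneg_right (by positivity))
  rwa [mul_add, mul_div_cancel₀ _ hc.ne'] at this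

lemma growth_of_ergodic {X : Set V} {ψ : V → V} (h : MapsTo ψ X X)
    (hψ : DifferentiableOn ℂ ψ X) {K : Set V} (hK : IsCompact K) (hKX : K ⊆ X)
    {f g : V → ℂ} (hf : DifferentiableOn ℂ f X) (hg : DifferentiableOn ℂ g X)
    (hlim : ∀ ε : ℝ, 0 < ε → ∃ N : ℕ, ∀ n : ℕ, N ≤ n → ∀ z ∈ K,
               ‖(n : ℂ)⁻¹ * (∑ m ∈ Finset.range n, f (ψ^[m + 1] z)) - g z‖ < ε) :
    ∃ M : ℝ, ∀ m : ℕ, 1 ≤ m → ∀ z ∈ K, ‖f (ψ^[m] z)‖ ≤ M * m := by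
  obtain ⟨N, hN⟩ := hlim 1 one_pos
  obtain ⟨G, hG⟩ := hK.exists_bound_of_continuousOn (hg.continuousOn.mono hKX)
  have hB : ∀ m : ℕ, ∃ B : ℝ, ∀ z ∈ K, ‖f (ψ^[m] z)‖ ≤ B := fun m =>
    hK.exists_bound_of_continuousOn
      ((hf.comp (iter_diff h hψ m) (h.iterate m)).continuousOn.mono hKX)
  choose B hB using hB
  have hsum : ∀ n, N ≤ n → ∀ z ∈ K, ‖∑ m ∈ Finset.range n, f (ψ^[m + 1] z)‖ ≤ n * (|G| + 1) := by
    intro n hn z hz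
    rcases Nat.eq_zero_or_pos n with rfl | hn0
    · simp
    have hn1 : (0 : ℝ) < n := by exact_mod_cast hn0
    rw [← inv_mul_le_iff₀ hn1]
    have h1 := hN n hn z hz
    have h2 := norm_add_le ((n : ℂ)⁻¹ * (∑ m ∈ Finset.range n, f (ψ^[m + 1] z)) - g z) (g z)
    rw [sub_add_cancel, norm_mul, norm_inv, Complex.norm_natCast] at h2
    linarith [hG z hz, le_abs_self G]
  have hS0 : 0 ≤ ∑ i ∈ Finset.range (N + 1), |B i| := Finset.sum_nonneg fun i _ => abs_nonneg _
  refine ⟨∑ i ∈ Finset.range (N + 1), |B i| + 2 * (|G| + 1), fun m hm z hz => ?_⟩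
  have hm1 : (1 : ℝ) ≤ m := by exact_mod_cast hm
  have hG0 := abs_nonneg G
  by_cases hmN : m ≤ N
  · have h1 := Finset.single_le_sum (f := fun i => |B i|) (fun i _ => abs_nonneg _)
      (Finset.mem_range.2 (by omega : m < N + 1))
    have h2 := (hB m z hz).trans (le_abs_self _)
    nlinarith
  · obtain ⟨k, rfl⟩ : ∃ k, m = k + 1 := ⟨m - 1, by omega⟩
    have h1 := hsum k (by omega) z hz
    have h2 := hsum (k + 1) (by omega) z hz
    have h3 : f (ψ^[k + 1] z) = ∑ m ∈ Finset.range (k + 1), f (ψ^[m + 1] z) -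
        ∑ m ∈ Finset.range k, f (ψ^[m + 1] z) := by
      rw [Finset.sum_range_succ]; ring
    rw [h3]
    refine (norm_sub_le _ _).trans ?_
    push_cast at *
    nlinarith

end PBC

/-- For a holomorphically convex open `X ⊆ ℂ^d`, a holomorphic weight
`w` and symbol `ψ` such that all sets `{z ∈ X : w(ψ^m(z)) ≠ 0}` are dense in `X`:
power boundedness of `C_{w,ψ}` on `ℋ(X)` is equivalent to topologizability together with
boundedness of `{C_{w,ψ}^m(w)}`, and to stable orbits of `ψ` together with boundedness of
`{C_{w,ψ}^m(w)}`; and if `w = 1` these are further equivalent to mean ergodicity of `C_ψ`. -/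
theorem power_bounded_characterization_holomorphic
    {d : ℕ} (X : Set (EuclideanSpace ℂ (Fin d))) (hX : IsOpen X)
    (hconv : ∀ K : Set (EuclideanSpace ℂ (Fin d)), IsCompact K → K ⊆ X →
      IsCompact {z ∈ X | ∀ f : EuclideanSpace ℂ (Fin d) → ℂ,
        DifferentiableOn ℂ f X → ‖f z‖ ≤ ⨆ u ∈ K, ‖f u‖})
    (w : EuclideanSpace ℂ (Fin d) → ℂ) (hw : DifferentiableOn ℂ w X)
    (ψ : EuclideanSpace ℂ (Fin d) → EuclideanSpace ℂ (Fin d))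
    (hψ : DifferentiableOn ℂ ψ X) (hψX : Set.MapsTo ψ X X)
    (hdense : ∀ m : ℕ, X ⊆ closure {z ∈ X | w (ψ^[m] z) ≠ 0}) :
    -- (i) ↔ (ii)
    ((∀ K : Set (EuclideanSpace ℂ (Fin d)), IsCompact K → K ⊆ X →
        ∃ L : Set (EuclideanSpace ℂ (Fin d)), IsCompact L ∧ L ⊆ X ∧ ∃ C : ℝ, 0 < C ∧
          ∀ m : ℕ, 1 ≤ m → ∀ f : EuclideanSpace ℂ (Fin d) → ℂ, DifferentiableOn ℂ f X →
            (⨆ z ∈ K, ‖(∏ j ∈ Finset.range m, w (ψ^[j] z)) * f (ψ^[m] z)‖) ≤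
              C * ⨆ u ∈ L, ‖f u‖) ↔
      ((∀ K : Set (EuclideanSpace ℂ (Fin d)), IsCompact K → K ⊆ X →
        ∃ L : Set (EuclideanSpace ℂ (Fin d)), IsCompact L ∧ L ⊆ X ∧
          ∀ m : ℕ, 1 ≤ m → ∃ γ : ℝ, 0 < γ ∧
            ∀ f : EuclideanSpace ℂ (Fin d) → ℂ, DifferentiableOn ℂ f X →
              (⨆ z ∈ K, ‖(∏ j ∈ Finset.range m, w (ψ^[j] z)) * f (ψ^[m] z)‖) ≤
                γ * ⨆ u ∈ L, ‖f u‖) ∧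
       (∀ K : Set (EuclideanSpace ℂ (Fin d)), IsCompact K → K ⊆ X →
        ∃ M : ℝ, ∀ m : ℕ, 1 ≤ m → ∀ z ∈ K,
          ‖(∏ j ∈ Finset.range m, w (ψ^[j] z)) * w (ψ^[m] z)‖ ≤ M))) ∧
    -- (ii) ↔ (iii)
    (((∀ K : Set (EuclideanSpace ℂ (Fin d)), IsCompact K → K ⊆ X →
        ∃ L : Set (EuclideanSpace ℂ (Fin d)), IsCompact L ∧ L ⊆ X ∧
          ∀ m : ℕ, 1 ≤ m → ∃ γ : ℝ, 0 < γ ∧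
            ∀ f : EuclideanSpace ℂ (Fin d) → ℂ, DifferentiableOn ℂ f X →
              (⨆ z ∈ K, ‖(∏ j ∈ Finset.range m, w (ψ^[j] z)) * f (ψ^[m] z)‖) ≤
                γ * ⨆ u ∈ L, ‖f u‖) ∧
      (∀ K : Set (EuclideanSpace ℂ (Fin d)), IsCompact K → K ⊆ X →
        ∃ M : ℝ, ∀ m : ℕ, 1 ≤ m → ∀ z ∈ K,
          ‖(∏ j ∈ Finset.range m, w (ψ^[j] z)) * w (ψ^[m] z)‖ ≤ M)) ↔
     ((∀ K : Set (EuclideanSpace ℂ (Fin d)), IsCompact K → K ⊆ X →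
        ∃ L : Set (EuclideanSpace ℂ (Fin d)), IsCompact L ∧ L ⊆ X ∧
          ∀ m : ℕ, 1 ≤ m → ψ^[m] '' K ⊆ L) ∧
      (∀ K : Set (EuclideanSpace ℂ (Fin d)), IsCompact K → K ⊆ X →
        ∃ M : ℝ, ∀ m : ℕ, 1 ≤ m → ∀ z ∈ K,
          ‖(∏ j ∈ Finset.range m, w (ψ^[j] z)) * w (ψ^[m] z)‖ ≤ M))) ∧
    -- if w = 1 on X, (i) is further equivalent to (iv) mean ergodicity of C_ψ
    ((∀ z ∈ X, w z = 1) →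
      ((∀ K : Set (EuclideanSpace ℂ (Fin d)), IsCompact K → K ⊆ X →
        ∃ L : Set (EuclideanSpace ℂ (Fin d)), IsCompact L ∧ L ⊆ X ∧ ∃ C : ℝ, 0 < C ∧
          ∀ m : ℕ, 1 ≤ m → ∀ f : EuclideanSpace ℂ (Fin d) → ℂ, DifferentiableOn ℂ f X →
            (⨆ z ∈ K, ‖(∏ j ∈ Finset.range m, w (ψ^[j] z)) * f (ψ^[m] z)‖) ≤
              C * ⨆ u ∈ L, ‖f u‖) ↔
       (∀ f : EuclideanSpace ℂ (Fin d) → ℂ, DifferentiableOn ℂ f X →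
         ∃ g : EuclideanSpace ℂ (Fin d) → ℂ, DifferentiableOn ℂ g X ∧
           ∀ K : Set (EuclideanSpace ℂ (Fin d)), IsCompact K → K ⊆ X →
             ∀ ε : ℝ, 0 < ε → ∃ N : ℕ, ∀ n : ℕ, N ≤ n → ∀ z ∈ K,
               ‖(n : ℂ)⁻¹ * (∑ m ∈ Finset.range n, f (ψ^[m + 1] z)) - g z‖ < ε))) := by
  have h13 := PBC.pb_of_stable (X := X) (ψ := ψ) hw
  have h23 := PBC.stable_of_top hX hconv hψX hψ hw hdense
  have hbw : (∀ K : Set (EuclideanSpace ℂ (Fin d)), IsCompact K → K ⊆ X →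
        ∃ L : Set (EuclideanSpace ℂ (Fin d)), IsCompact L ∧ L ⊆ X ∧ ∃ C : ℝ, 0 < C ∧
          ∀ m : ℕ, 1 ≤ m → ∀ f : EuclideanSpace ℂ (Fin d) → ℂ, DifferentiableOn ℂ f X →
            (⨆ z ∈ K, ‖(∏ j ∈ Finset.range m, w (ψ^[j] z)) * f (ψ^[m] z)‖) ≤
              C * ⨆ u ∈ L, ‖f u‖) →
      (∀ K : Set (EuclideanSpace ℂ (Fin d)), IsCompact K → K ⊆ X →
        ∃ M : ℝ, ∀ m : ℕ, 1 ≤ m → ∀ z ∈ K,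
          ‖(∏ j ∈ Finset.range m, w (ψ^[j] z)) * w (ψ^[m] z)‖ ≤ M) := by
    intro hi K hK hKX
    obtain ⟨L, hL, hLX, C, hC, H⟩ := hi K hK hKX
    refine ⟨C * ⨆ u ∈ L, ‖w u‖, fun m hm z hz => ?_⟩
    refine le_trans ?_ (H m hm w hw)
    have hd : DifferentiableOn ℂ
        (fun z => (∏ j ∈ Finset.range m, w (ψ^[j] z)) * w (ψ^[m] z)) X :=
      (PBC.prod_diff hψX hψ hw m).mul (hw.comp (PBC.iter_diff hψX hψ m) (hψX.iterate m))
    exact PBC.le_sup hK (hd.continuousOn.mono hKX) hz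
  have htop : (∀ K : Set (EuclideanSpace ℂ (Fin d)), IsCompact K → K ⊆ X →
        ∃ L : Set (EuclideanSpace ℂ (Fin d)), IsCompact L ∧ L ⊆ X ∧ ∃ C : ℝ, 0 < C ∧
          ∀ m : ℕ, 1 ≤ m → ∀ f : EuclideanSpace ℂ (Fin d) → ℂ, DifferentiableOn ℂ f X →
            (⨆ z ∈ K, ‖(∏ j ∈ Finset.range m, w (ψ^[j] z)) * f (ψ^[m] z)‖) ≤
              C * ⨆ u ∈ L, ‖f u‖) →
      (∀ K : Set (EuclideanSpace ℂ (Fin d)), IsCompact K → K ⊆ X →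
        ∃ L : Set (EuclideanSpace ℂ (Fin d)), IsCompact L ∧ L ⊆ X ∧
          ∀ m : ℕ, 1 ≤ m → ∃ γ : ℝ, 0 < γ ∧
            ∀ f : EuclideanSpace ℂ (Fin d) → ℂ, DifferentiableOn ℂ f X →
              (⨆ z ∈ K, ‖(∏ j ∈ Finset.range m, w (ψ^[j] z)) * f (ψ^[m] z)‖) ≤
                γ * ⨆ u ∈ L, ‖f u‖) := by
    intro hi K hK hKX
    obtain ⟨L, hL, hLX, C, hC, H⟩ := hi K hK hKX
    exact ⟨L, hL, hLX, fun m hm => ⟨C, hC, H m hm⟩⟩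
  refine ⟨⟨fun hi => ⟨htop hi, hbw hi⟩, fun hii => h13 (h23 hii.1) hii.2⟩,
    ⟨fun hii => ⟨h23 hii.1, hii.2⟩, fun hiii => ⟨htop (h13 hiii.1 hiii.2), hiii.2⟩⟩,
    fun hw1 => ⟨fun hi f hf => PBC.ergodic_of_stable hX hψX hψ (h23 (htop hi)) f hf,
      fun hiv => ?_⟩⟩
  have hprod : ∀ z ∈ X, ∀ m : ℕ, ∏ j ∈ Finset.range m, w (ψ^[j] z) = 1 := fun z hz m =>
    Finset.prod_eq_one fun j _ => hw1 _ (hψX.iterate j hz)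
  refine h13 (h23 fun K hK hKX => ?_) fun K hK hKX => ⟨1, fun m hm z hz => ?_⟩
  · obtain ⟨L, hL, hLX, H⟩ := PBC.top_of_pointwise hX hψX hKX (fun f hf => by
      obtain ⟨g, hg, hlim⟩ := hiv f hf
      exact PBC.growth_of_ergodic hψX hψ hK hKX hf hg (hlim K hK hKX))
    refine ⟨L, hL, hLX, fun m hm => ?_⟩
    obtain ⟨γ, hγ, H⟩ := H m hm
    refine ⟨γ, hγ, fun f hf => ?_⟩
    refine PBC.sup_le (mul_nonneg hγ.le (PBC.sup_nonneg _ _)) fun z hz => ?_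
    rw [hprod z (hKX hz), one_mul]
    exact H f hf z hz
  · rw [hprod z (hKX hz), hw1 _ (hψX.iterate m (hKX hz))]
    simp

end
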